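/- Every rooted tree T of depth d ≥ 1 (a finite tree with a distinguished root vertex r such that every vertex is at distance at most d from r) satisfies γ_e(T) ≤ 2^{2d − 2}. -/

import Mathlib

open SimpleGraph

/-- The contribution `(1/2)^(d-1)` of a vertex at `S`-restricted distance `d`,
with `(1/2)^∞ = 0`. -/
noncomputable def expStep (d : ℕ∞) : ℝ :=
  if h : d = ⊤ then 0 else (1 / 2 : ℝ) ^ ((d.untop h : ℤ) - 1)

/-- `expDist G S u v` is the minimum number of edges of a walk in `G` from `u` to `v`
such that `v` is the only vertex of the walk belonging to `S` (i.e. the distance from `u`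
to `v ∈ S` in `G - (S \ {v})`), and `⊤` if no such walk exists. -/
noncomputable def expDist {V : Type*} (G : SimpleGraph V) (S : Finset V) (u v : V) : ℕ∞ :=
  sInf {n : ℕ∞ | ∃ p : G.Walk u v, (∀ x ∈ p.support, x ∈ S → x = v) ∧ (p.length : ℕ∞) = n}

/-- The weight `w_{(G,S)}(u) = Σ_{v ∈ S} (1/2)^(dist_{(G,S)}(u,v) - 1)`. -/
noncomputable def expWeight {V : Type*} (G : SimpleGraph V) (S : Finset V) (u : V) : ℝ :=
  ∑ v ∈ S, expStep (expDist G S u v)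

/-- `S` is an exponential dominating set of `G`. -/
def IsExpDomSet {V : Type*} (G : SimpleGraph V) (S : Finset V) : Prop :=
  ∀ u : V, 1 ≤ expWeight G S u

/-- The exponential domination number of `G`. -/
noncomputable def expDomNum {V : Type*} (G : SimpleGraph V) : ℕ :=
  sInf {k : ℕ | ∃ S : Finset V, IsExpDomSet G S ∧ S.card = k}

lemma expStep_coe (n : ℕ) : expStep (n : ℕ∞) = 2 * (1 / 2 : ℝ) ^ n := by
  have h : (n : ℕ∞) ≠ ⊤ := ENat.natCast_ne_top n
  have hn : ((n : ℕ∞).untop h : ℕ) = n := by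
    apply ENat.natCast_inj.mp
    exact WithTop.coe_untop _ h
  unfold expStep
  rw [dif_neg h, hn, zpow_sub_one₀ (by norm_num), zpow_natCast]
  ring

lemma expStep_nonneg (d : ℕ∞) : 0 ≤ expStep d := by
  unfold expStep
  split_ifs
  · exact le_rfl
  · positivity

lemma le_expStep {d : ℕ∞} {n : ℕ} (h : d ≤ n) : 2 * (1 / 2 : ℝ) ^ n ≤ expStep d := by
  lift d to ℕ using ne_top_of_le_ne_top (ENat.natCast_ne_top n) h
  rw [expStep_coe]
  have := pow_le_pow_of_le_one (by norm_num : (0 : ℝ) ≤ 1 / 2) (by norm_num)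
    (Nat.cast_le.mp h)
  linarith

/-- A certificate for `u` having weight at least `1`: at least `2 ^ (n - 1)` vertices of `S` are
reached from `u` by `S`-avoiding walks of length at most `n` that do not go further away from `r`
than their endvertices. -/
def IsExpDominated {V : Type*} (G : SimpleGraph V) (r : V) (S : Finset V) (u : V) : Prop :=
  ∃ A ⊆ S, ∃ n : ℕ, 2 ^ n ≤ 2 * A.card ∧ ∀ v ∈ A, ∃ p : G.Walk u v, p.length ≤ n ∧
    ∀ x ∈ p.support, (x ∈ S → x = v) ∧ G.dist r x ≤ max (G.dist r u) (G.dist r v)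

namespace IsExpDominated

variable {V : Type*} {G : SimpleGraph V} {r u : V} {S : Finset V}

lemma one_le_expWeight (h : IsExpDominated G r S u) : 1 ≤ expWeight G S u := by
  obtain ⟨A, hA, n, hn, hw⟩ := h
  have hsum : (A.card : ℝ) * (2 * (1 / 2 : ℝ) ^ n) ≤ ∑ v ∈ A, expStep (expDist G S u v) := by
    rw [← nsmul_eq_mul]
    refine Finset.card_nsmul_le_sum _ _ _ fun v hv => ?_
    obtain ⟨p, hp, hx⟩ := hw v hv
    refine le_expStep (le_trans (sInf_le ⟨p, fun x hxp => (hx x hxp).1, rfl⟩) ?_)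
    exact_mod_cast hp
  have hcard : (2 : ℝ) ^ n ≤ 2 * A.card := by exact_mod_cast hn
  have hone : (1 : ℝ) = 2 ^ n * (1 / 2) ^ n := by rw [← mul_pow]; norm_num
  calc (1 : ℝ) = 2 ^ n * (1 / 2) ^ n := hone
    _ ≤ (2 * A.card) * (1 / 2) ^ n := by gcongr
    _ = A.card * (2 * (1 / 2 : ℝ) ^ n) := by ring
    _ ≤ _ := hsum
    _ ≤ _ := Finset.sum_le_sum_of_subset_of_nonneg hA fun _ _ _ => expStep_nonneg _

lemma of_mem (hu : u ∈ S) : IsExpDominated G r S u :=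
  ⟨{u}, by simpa using hu, 0, by simp, fun v hv => by
    obtain rfl := Finset.mem_singleton.mp hv
    exact ⟨Walk.nil, by simp, by simp⟩⟩

lemma of_adj {w : V} (hw : w ∈ S) (h : G.Adj u w) : IsExpDominated G r S u := by
  by_cases hu : u ∈ S
  · exact of_mem hu
  refine ⟨{w}, by simpa using hw, 1, by simp, fun v hv => ?_⟩
  obtain rfl := Finset.mem_singleton.mp hv
  refine ⟨h.toWalk, by simp, fun x hx => ?_⟩
  have hx' : x = u ∨ x = v := by simpa using hx
  rcases hx' with rfl | rfl
  · exact ⟨fun h => absurd h hu, le_max_left _ _⟩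
  · exact ⟨fun _ => rfl, le_max_right _ _⟩

lemma union [DecidableEq V] {k : ℕ} {N : Finset V} (h : IsExpDominated G r S u)
    (hu : G.dist r u ≤ k) (hS : ∀ v ∈ S, G.dist r v ≤ k) (hN : ∀ v ∈ N, k < G.dist r v) :
    IsExpDominated G r (S ∪ N) u := by
  obtain ⟨A, hA, n, hn, hw⟩ := h
  refine ⟨A, hA.trans Finset.subset_union_left, n, hn, fun v hv => ?_⟩
  obtain ⟨p, hp, hx⟩ := hw v hv
  refine ⟨p, hp, fun x hxp => ⟨fun hxS => ?_, (hx x hxp).2⟩⟩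
  rcases Finset.mem_union.mp hxS with hxS | hxN
  · exact (hx x hxp).1 hxS
  · have := hN x hxN
    have := (hx x hxp).2
    have := max_le hu (hS v (hA hv))
    omega

end IsExpDominated

namespace SimpleGraph.Connected

variable {V : Type*} {G : SimpleGraph V}

lemma exists_walk_dist_lt (hG : G.Connected) (r u : V) :
    ∃ p : G.Walk r u, p.length = G.dist r u ∧
      ∀ x ∈ p.support, x = u ∨ G.dist r x < G.dist r u := by
  classical
  obtain ⟨p, hp⟩ := hG.exists_walk_length_eq_dist r u
  refine ⟨p, hp, fun x hx => or_iff_not_imp_left.mpr fun hxu => ?_⟩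
  have h1 := dist_le (p.takeUntil x hx)
  have h2 := p.length_takeUntil_lt_length hx hxu
  omega

lemma exists_walk_through (hG : G.Connected) (r u v : V) :
    ∃ p : G.Walk u v, p.length = G.dist r u + G.dist r v ∧
      ∀ x ∈ p.support, x = u ∨ x = v ∨ G.dist r x < max (G.dist r u) (G.dist r v) := by
  obtain ⟨p, hp, hpx⟩ := hG.exists_walk_dist_lt r u
  obtain ⟨q, hq, hqx⟩ := hG.exists_walk_dist_lt r v
  refine ⟨p.reverse.append q, by simp [hp, hq], fun x hx => ?_⟩
  rw [Walk.mem_support_append_iff, Walk.support_reverse, List.mem_reverse] at hx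
  rcases hx with hx | hx
  · rcases hpx x hx with h | h
    · exact .inl h
    · exact .inr (.inr (lt_max_of_lt_left h))
  · rcases hqx x hx with h | h
    · exact .inr (.inl h)
    · exact .inr (.inr (lt_max_of_lt_right h))

lemma exists_adj_dist_eq (hG : G.Connected) {r u : V} {k : ℕ} (hu : G.dist r u = k + 1) :
    ∃ w, G.Adj u w ∧ G.dist r w = k := by
  obtain ⟨p, hp⟩ := hG.exists_walk_length_eq_dist u r
  rw [dist_comm, hu] at hp
  cases p with
  | nil => simp at hp
  | @cons _ w _ h q =>
    refine ⟨w, h, ?_⟩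
    have h1 := dist_le q
    rw [dist_comm] at h1
    have h2 := hG.dist_triangle (u := r) (v := w) (w := u)
    rw [(dist_eq_one_iff_adj).mpr h.symm] at h2
    rw [Walk.length_cons] at hp
    omega

/-- A large set of vertices at distance `k` from `r` dominates all vertices at distance at most
`k` from `r`. -/
lemma isExpDominated_of_dist_le (hG : G.Connected) {r u : V} {k : ℕ} {M : Finset V}
    (hM : ∀ v ∈ M, G.dist r v = k) (hu : G.dist r u ≤ k)
    (hcard : 2 ^ (G.dist r u + k) ≤ 2 * M.card) : IsExpDominated G r M u := by
  by_cases huM : u ∈ M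
  · exact .of_mem huM
  refine ⟨M, subset_rfl, _, hcard, fun v hv => ?_⟩
  obtain ⟨p, hp, hx⟩ := hG.exists_walk_through r u v
  refine ⟨p, by rw [hp, hM v hv], fun x hxp => ?_⟩
  rcases hx x hxp with rfl | rfl | h
  · exact ⟨fun h => absurd h huM, le_max_left _ _⟩
  · exact ⟨fun _ => rfl, le_max_right _ _⟩
  · refine ⟨fun hxM => ?_, h.le⟩
    rw [hM v hv, hM x hxM, max_eq_right hu] at h
    exact absurd h (lt_irrefl _)

lemma isExpDominated_of_dist_eq_succ (hG : G.Connected) {r u : V} {k : ℕ} {M : Finset V}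
    (hM : ∀ v ∈ M, G.dist r v = k) (hu : G.dist r u = k + 1)
    (hcard : 2 ^ (2 * k + 1) ≤ 2 * M.card) : IsExpDominated G r M u := by
  obtain ⟨w, huw, hw⟩ := hG.exists_adj_dist_eq hu
  by_cases hwM : w ∈ M
  · exact .of_adj hwM huw
  refine ⟨M, subset_rfl, _, hcard, fun v hv => ?_⟩
  obtain ⟨p, hp, hx⟩ := hG.exists_walk_through r w v
  have hv' := hM v hv
  refine ⟨p.cons huw, by rw [Walk.length_cons, hp]; omega, fun x hxp => ?_⟩
  rw [Walk.support_cons, List.mem_cons] at hxp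
  rcases hxp with rfl | hxp
  · exact ⟨fun h => by have := hM x h; omega, le_max_left _ _⟩
  rcases hx x hxp with rfl | rfl | h
  · exact ⟨fun h => absurd h hwM, by omega⟩
  · exact ⟨fun _ => rfl, le_max_right _ _⟩
  · exact ⟨fun hxM => by have := hM x hxM; omega, by omega⟩

lemma exists_isExpDominated [Fintype V] (hG : G.Connected) (r : V) (k : ℕ) :
    ∃ S : Finset V, S.card ≤ 4 ^ k ∧ (∀ v ∈ S, G.dist r v ≤ k) ∧
      ∀ u, G.dist r u ≤ k + 1 → IsExpDominated G r S u := by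
  classical
  induction k with
  | zero =>
    refine ⟨{r}, by simp, by simp, fun u hu => ?_⟩
    rcases hu.eq_or_lt with h | h
    · exact hG.isExpDominated_of_dist_eq_succ (k := 0) (by simp) h (by simp)
    · exact hG.isExpDominated_of_dist_le (k := 0) (by simp) (by omega)
        (by rw [show G.dist r u = 0 by omega]; simp)
  | succ k ih =>
    set N : Finset V := {v | G.dist r v = k + 1} with hN
    have hNd : ∀ v, v ∈ N ↔ G.dist r v = k + 1 := by simp [hN]
    have hsucc : ∀ S : Finset V, N ⊆ S → ∀ u, k + 1 ≤ G.dist r u → G.dist r u ≤ k + 1 + 1 →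
        IsExpDominated G r S u := by
      intro S hS u hu hu'
      rcases hu.eq_or_lt with h | h
      · exact .of_mem (hS ((hNd u).mpr h.symm))
      · obtain ⟨w, huw, hw⟩ := hG.exists_adj_dist_eq (r := r) (u := u) (k := k + 1) (by omega)
        exact .of_adj (hS ((hNd w).mpr hw)) huw
    rcases lt_or_ge N.card (4 ^ k) with hlt | hge
    · obtain ⟨S, hcard, hS, hdom⟩ := ih
      refine ⟨S ∪ N, ?_, fun v hv => ?_, fun u hu => ?_⟩
      · have := Finset.card_union_le S N
        rw [pow_succ]
        omega
      · rcases Finset.mem_union.mp hv with h | h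
        · exact (hS v h).trans (Nat.le_succ k)
        · exact ((hNd v).mp h).le
      · rcases lt_or_ge (G.dist r u) (k + 1) with h | h
        · exact (hdom u h.le).union (Nat.lt_succ_iff.mp h) hS
            fun v hv => by rw [(hNd v).mp hv]; exact Nat.lt_succ_self k
        · exact hsucc _ Finset.subset_union_right u h hu
    · obtain ⟨M, hMN, hM⟩ := Finset.exists_subset_card_eq (min_le_left N.card (4 ^ (k + 1)))
      have hMd : ∀ v ∈ M, G.dist r v = k + 1 := fun v hv => (hNd v).mp (hMN hv)
      refine ⟨M, hM.trans_le (min_le_right _ _), fun v hv => (hMd v hv).le, fun u hu => ?_⟩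
      have h4 : ∀ j : ℕ, 2 ^ (2 * j + 1) = 2 * 4 ^ j := fun j => by
        rw [pow_succ, pow_mul, mul_comm]; norm_num
      rcases lt_or_ge (G.dist r u) (k + 1) with h | h
      · refine hG.isExpDominated_of_dist_le hMd h.le ?_
        have hMk : 4 ^ k ≤ M.card := by
          rw [hM]
          exact le_min hge (Nat.pow_le_pow_right (by norm_num) (Nat.le_succ k))
        calc 2 ^ (G.dist r u + (k + 1)) ≤ 2 ^ (2 * k + 1) :=
              Nat.pow_le_pow_right (by norm_num) (by omega)
          _ = 2 * 4 ^ k := h4 k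
          _ ≤ 2 * M.card := by omega
      · rcases le_total N.card (4 ^ (k + 1)) with hle | hle
        · rw [min_eq_left hle] at hM
          exact hsucc M (Finset.eq_of_subset_of_card_le hMN hM.ge).ge u h hu
        · rw [min_eq_right hle] at hM
          have hcard : 2 ^ (2 * (k + 1) + 1) ≤ 2 * M.card := by rw [h4, hM]
          rcases h.eq_or_lt with h | h
          · exact hG.isExpDominated_of_dist_le hMd h.ge
              ((Nat.pow_le_pow_right (by norm_num) (by omega)).trans hcard)
          · exact hG.isExpDominated_of_dist_eq_succ hMd (by omega) hcard

end SimpleGraph.Connected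

/-- Every rooted tree of depth `d ≥ 1` (every vertex at distance at most `d`
from the root `r`) satisfies `γ_e(T) ≤ 2^(2d-2)`. -/
theorem expDomNum_le_of_depth {V : Type*} [Fintype V]
    (T : SimpleGraph V) (hT : T.IsTree) (r : V) (d : ℕ) (hd : 1 ≤ d)
    (hdepth : ∀ v : V, T.dist r v ≤ d) :
    expDomNum T ≤ 2 ^ (2 * d - 2) := by
  obtain ⟨k, rfl⟩ := Nat.exists_eq_add_of_le' hd
  obtain ⟨S, hcard, -, hdom⟩ := hT.connected.exists_isExpDominated r k
  calc expDomNum T ≤ S.card :=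
        Nat.sInf_le ⟨S, fun u => (hdom u (hdepth u)).one_le_expWeight, rfl⟩
    _ ≤ 4 ^ k := hcard
    _ = 2 ^ (2 * (k + 1) - 2) := by
        rw [show 2 * (k + 1) - 2 = 2 * k by omega, pow_mul]
        norm_num
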